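/- Let n ≥ 1, p ∈ ℍⁿ, let v ∈ T_pℍⁿ be nonzero, and let w₁, w₂ ∈ T_pℍⁿ. Define φ_t(w) = ⟨w,v̂⟩_M · (sinh(‖v‖t)·p + cosh(‖v‖t)·v̂) + w − ⟨w,v̂⟩_M · v̂. Then parallel transport along the geodesic preserves the Minkowski inner product of tangent vectors: for every t ∈ ℝ, ⟨φ_t(w₁), φ_t(w₂)⟩_M = ⟨w₁, w₂⟩_M. In particular, lengths and angles of tangent vectors are preserved. -/

import Mathlib

/-- The Minkowski dot product on ℝ^{n+1}: ⟨u,v⟩_M = Σ_{i<n} uᵢvᵢ − uₙvₙ. -/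
noncomputable def mink {n : ℕ} (u v : Fin (n + 1) → ℝ) : ℝ :=
  (∑ i : Fin n, u i.castSucc * v i.castSucc) - u (Fin.last n) * v (Fin.last n)

/-- The hyperboloid model ℍⁿ ⊆ ℝ^{(n,1)}. -/
def Hyperboloid (n : ℕ) : Set (Fin (n + 1) → ℝ) :=
  {x | mink x x = -1 ∧ 0 < x (Fin.last n)}

/-- The tangent space to the hyperboloid at p. -/
def Tangent {n : ℕ} (p : Fin (n + 1) → ℝ) : Set (Fin (n + 1) → ℝ) :=
  {x | mink x p = 0}

/-- The Minkowski norm ‖v‖ = √⟨v,v⟩_M. -/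
noncomputable def mnorm {n : ℕ} (v : Fin (n + 1) → ℝ) : ℝ :=
  Real.sqrt (mink v v)

/-- The normalisation v̂ = v / ‖v‖. -/
noncomputable def munit {n : ℕ} (v : Fin (n + 1) → ℝ) : Fin (n + 1) → ℝ :=
  (mnorm v)⁻¹ • v

/-- The geodesic γ_{p,v}(t) = cosh(‖v‖t)·p + sinh(‖v‖t)·v̂. -/
noncomputable def geo {n : ℕ} (p v : Fin (n + 1) → ℝ) (t : ℝ) : Fin (n + 1) → ℝ :=
  Real.cosh (mnorm v * t) • p + Real.sinh (mnorm v * t) • munit v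

/-- The geodesic velocity γ'_{p,v}(t) = ‖v‖sinh(‖v‖t)·p + ‖v‖cosh(‖v‖t)·v̂. -/
noncomputable def geo' {n : ℕ} (p v : Fin (n + 1) → ℝ) (t : ℝ) : Fin (n + 1) → ℝ :=
  (mnorm v * Real.sinh (mnorm v * t)) • p + (mnorm v * Real.cosh (mnorm v * t)) • munit v

/-- Inverse hyperbolic cosine. -/
noncomputable def arccosh (x : ℝ) : ℝ :=
  Real.log (x + Real.sqrt (x ^ 2 - 1))

/-- Parallel transport of w along the geodesic γ_{p,v}. -/
noncomputable def ptransp {n : ℕ} (p v w : Fin (n + 1) → ℝ) (t : ℝ) : Fin (n + 1) → ℝ :=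
  mink w (munit v) • (Real.sinh (mnorm v * t) • p + Real.cosh (mnorm v * t) • munit v)
    + w - mink w (munit v) • munit v

/-- The Minkowski gradient of f at x. -/
noncomputable def minkGrad {n : ℕ} (f : (Fin (n + 1) → ℝ) → ℝ) (x : Fin (n + 1) → ℝ) :
    Fin (n + 1) → ℝ :=
  fun i => if i = Fin.last n then -(fderiv ℝ f x (Pi.single i 1)) else fderiv ℝ f x (Pi.single i 1)

/-- The logistic sigmoid. -/
noncomputable def sigmoid (x : ℝ) : ℝ := 1 / (1 + Real.exp (-x))

section Bilinearity

variable {n : ℕ} (u v w : Fin (n + 1) → ℝ) (c : ℝ)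

theorem mink_comm : mink u v = mink v u := by
  simp only [mink, mul_comm]

theorem mink_add_left : mink (u + v) w = mink u w + mink v w := by
  simp only [mink, Pi.add_apply, add_mul, Finset.sum_add_distrib]
  ring

theorem mink_smul_left : mink (c • u) v = c * mink u v := by
  simp only [mink, Pi.smul_apply, smul_eq_mul, mul_assoc, ← Finset.mul_sum, mul_sub]

theorem mink_sub_left : mink (u - v) w = mink u w - mink v w := by
  simp only [mink, Pi.sub_apply, sub_mul, Finset.sum_sub_distrib]
  ring

theorem mink_add_right : mink u (v + w) = mink u v + mink u w := by
  rw [mink_comm, mink_add_left, mink_comm v, mink_comm w]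

theorem mink_smul_right : mink u (c • v) = c * mink u v := by
  rw [mink_comm, mink_smul_left, mink_comm v]

theorem mink_sub_right : mink u (v - w) = mink u v - mink u w := by
  rw [mink_comm, mink_sub_left, mink_comm v, mink_comm w]

end Bilinearity

/-- Nonzero tangent vectors to the hyperboloid are spacelike. -/
theorem mink_self_pos {n : ℕ} {p v : Fin (n + 1) → ℝ} (hp : p ∈ Hyperboloid n)
    (hv : v ∈ Tangent p) (hv0 : v ≠ 0) : 0 < mink v v := by
  obtain ⟨hpp, hpos⟩ := hp
  have hvp : mink v p = 0 := hv
  have cauchy := Finset.sum_mul_sq_le_sq_mul_sq Finset.univ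
    (fun i : Fin n => v i.castSucc) (fun i : Fin n => p i.castSucc)
  have hV : 0 ≤ ∑ i : Fin n, v i.castSucc ^ 2 := Finset.sum_nonneg fun i _ => sq_nonneg _
  simp only [mink, ← pow_two] at hpp hvp ⊢
  rw [sub_eq_zero.mp hvp, eq_add_of_sub_eq hpp] at cauchy
  by_contra! hle
  have hV0 : ∑ i : Fin n, v i.castSucc ^ 2 = 0 := by
    nlinarith [mul_nonneg (sub_nonneg.mpr (sub_nonpos.mp hle)) (sq_nonneg (p (Fin.last n)))]
  have hspace : ∀ i : Fin n, v i.castSucc = 0 := fun i =>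
    pow_eq_zero_iff two_ne_zero |>.mp <|
      (Finset.sum_eq_zero_iff_of_nonneg fun i _ => sq_nonneg _).mp hV0 i (Finset.mem_univ i)
  have htime : v (Fin.last n) = 0 := by
    simpa [hspace, hpos.ne'] using hvp
  exact hv0 (funext fun i => Fin.lastCases htime hspace i)

theorem mink_munit_self {n : ℕ} {v : Fin (n + 1) → ℝ} (h : 0 < mink v v) :
    mink (munit v) (munit v) = 1 := by
  rw [munit, mink_smul_left, mink_smul_right, mnorm]
  have hs := Real.sqrt_pos.mpr h
  field_simp
  exact (Real.sq_sqrt h.le).symm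

/-- Parallel transport preserves the Minkowski inner product of tangent vectors. -/
theorem ptransp_isometry {n : ℕ} (hn : 1 ≤ n)
    (p : Fin (n + 1) → ℝ) (hp : p ∈ Hyperboloid n)
    (v : Fin (n + 1) → ℝ) (hv : v ∈ Tangent p) (hv0 : v ≠ 0)
    (w₁ w₂ : Fin (n + 1) → ℝ) (hw₁ : w₁ ∈ Tangent p) (hw₂ : w₂ ∈ Tangent p) (t : ℝ) :
    mink (ptransp p v w₁ t) (ptransp p v w₂ t) = mink w₁ w₂ := by
  have hpp : mink p p = -1 := hp.1
  have h₁ : mink w₁ p = 0 := hw₁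
  have h₂ : mink w₂ p = 0 := hw₂
  have hvp : mink v p = 0 := hv
  have huu := mink_munit_self (mink_self_pos hp hv hv0)
  have hup : mink (munit v) p = 0 := by rw [munit, mink_smul_left, hvp, mul_zero]
  simp only [ptransp, mink_add_left, mink_add_right, mink_sub_left, mink_sub_right,
    mink_smul_left, mink_smul_right, mink_comm p (munit v), mink_comm p w₂,
    mink_comm (munit v) w₂, hpp, h₁, h₂, huu, hup]
  linear_combination
    mink w₁ (munit v) * mink w₂ (munit v) * Real.cosh_sq (mnorm v * t)
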